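/- arXiv:2210.10588 — 3 statements merged into one kernel-verified Lean document; each statement's English description precedes it below -/
import Mathlib

section
/- Let f : ℂ → ℝ be C² and G_k the cumulant polynomial built from f. For k ≥ 3, z_0 ∈ ℂ and m, l ∈ {1,2}, the sum over all ordered pairs (r_1, r_2) with 1 ≤ r_1 ≠ r_2 ≤ k of (∂_{r_1 m} ∂_{r_2 l} G_k)(z_0,…,z_0) equals zero. -/
open scoped BigOperators

/-- The cumulant polynomial
`G_k(z_1,…,z_k) = Σ_{j=1}^k ((-1)^{j-1}/j) Σ_{k_1+⋯+k_j=k, k_i≥1}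
  (k!/(k_1!⋯k_j!)) Π_{l=1}^j f(z_l)^{k_l}`,
realized as a sum over `Composition k` (with `c.length` playing the role of `j`). -/
noncomputable def cumulantG (f : ℂ → ℝ) (k : ℕ) (z : Fin k → ℂ) : ℝ :=
  ∑ c : Composition k,
    ((-1 : ℝ) ^ (c.length - 1) / (c.length : ℝ)) *
      ((Nat.factorial k : ℝ) /
        ∏ i : Fin c.length, (Nat.factorial (c.blocksFun i) : ℝ)) *
      ∏ i : Fin c.length, f (z (Fin.castLE c.length_le i)) ^ (c.blocksFun i)

/-- The unit vector of `ℂ^k ≅ (ℝ²)^k` pointing in the `j`-th real coordinate direction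
(`j = 0`: real part, `j = 1`: imaginary part) of the `r`-th variable.  Differentiating
along `coordDir k r j` is the partial derivative `∂_{r j}` with respect to the `j`-th
real coordinate of the `r`-th complex variable. -/
noncomputable def coordDir (k : ℕ) (r : Fin k) (j : Fin 2) : Fin k → ℂ :=
  Pi.single r (if j = 0 then (1 : ℂ) else Complex.I)

/-- The power series `exp X - 1`. -/
noncomputable def expSubOne : PowerSeries ℝ := PowerSeries.exp ℝ - 1

lemma coeff_expSubOne (n : ℕ) :
    PowerSeries.coeff n expSubOne = if n = 0 then 0 else ((n.factorial : ℝ))⁻¹ := by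
  by_cases h : n = 0 <;> simp [expSubOne, PowerSeries.coeff_exp, PowerSeries.coeff_one, h]

lemma X_dvd_expSubOne : (PowerSeries.X : PowerSeries ℝ) ∣ expSubOne := by
  rw [PowerSeries.X_dvd_iff, ← PowerSeries.coeff_zero_eq_constantCoeff_apply, coeff_expSubOne]
  simp

lemma coeff_X_mul_exp (n : ℕ) :
    PowerSeries.coeff n (PowerSeries.X * PowerSeries.exp ℝ) =
      n * PowerSeries.coeff n expSubOne := by
  rw [coeff_expSubOne]
  cases n with
  | zero => simp
  | succ n =>
    rw [PowerSeries.coeff_succ_X_mul, PowerSeries.coeff_exp]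
    have : ((n : ℝ) + 1) ≠ 0 := by positivity
    simp [Nat.factorial_succ]
    field_simp

lemma prod_ite_eq_or_eq {ι M : Type*} [Fintype ι] [DecidableEq ι] [CommMonoid M]
    {r s : ι} (hrs : r ≠ s) (g : ι → M) (a : M) :
    ∏ i, (if i = r ∨ i = s then g i else a) = g r * g s * a ^ (Fintype.card ι - 2) := by
  have h : Finset.univ.filter (fun i => i = r ∨ i = s) = {r, s} := by ext; simp
  have h' : Finset.univ.filter (fun i => ¬ (i = r ∨ i = s)) = ({r, s} : Finset ι)ᶜ := by
    ext; simp
  rw [Finset.prod_ite, h, h', Finset.prod_pair hrs, Finset.prod_const, Finset.card_compl,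
    Finset.card_pair hrs]

lemma sum_finsuppAntidiag_mul_pair (n k : ℕ) {r s : Fin n} (hrs : r ≠ s) :
    ∑ φ ∈ Finset.finsuppAntidiag (Finset.univ : Finset (Fin n)) k,
      (∏ i, PowerSeries.coeff (φ i) expSubOne) * ((φ r : ℝ) * (φ s : ℝ)) =
    PowerSeries.coeff k
      ((PowerSeries.X * PowerSeries.exp ℝ) ^ 2 * expSubOne ^ (n - 2)) := by
  have h := prod_ite_eq_or_eq hrs (fun _ => PowerSeries.X * PowerSeries.exp ℝ) expSubOne
  rw [Fintype.card_fin, ← sq] at h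
  rw [← h, PowerSeries.coeff_prod]
  refine Finset.sum_congr rfl fun φ _ => ?_
  have h2 := prod_ite_eq_or_eq hrs (fun i => (φ i : ℝ)) 1
  rw [one_pow, mul_one] at h2
  rw [← h2, ← Finset.prod_mul_distrib]
  refine Finset.prod_congr rfl fun i _ => ?_
  split_ifs
  · rw [coeff_X_mul_exp, mul_comm]
  · simp

lemma card_filter_fst_ne_snd (n : ℕ) :
    (Finset.univ.filter (fun p : Fin n × Fin n => p.1 ≠ p.2)).card = n * (n - 1) := by
  have h : Finset.univ.filter (fun p : Fin n × Fin n => p.1 ≠ p.2) =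
      (Finset.univ : Finset (Fin n)).offDiag := by ext; simp
  rw [h, Finset.offDiag_card, Finset.card_univ, Fintype.card_fin, Nat.mul_sub, mul_one]

lemma one_sub_sq_mul_sum {R : Type*} [CommRing R] (u : R) (n : ℕ) :
    (1 - u) ^ 2 * ∑ i ∈ Finset.range n, ((i : R) + 1) * u ^ i =
      1 - (n + 1) * u ^ n + n * u ^ (n + 1) := by
  induction n with
  | zero => simp
  | succ n ih => rw [Finset.sum_range_succ, mul_add, ih]; push_cast; ring

lemma sum_coeff_eq_zero {k : ℕ} (hk : 3 ≤ k) :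
    ∑ n ∈ Finset.range (k + 1), ((-1 : ℝ) ^ (n - 1) / n) * ((n * (n - 1) : ℕ) *
      PowerSeries.coeff k
        ((PowerSeries.X * PowerSeries.exp ℝ) ^ 2 * expSubOne ^ (n - 2))) = 0 := by
  obtain ⟨N, rfl⟩ : ∃ N, k = N + 1 := ⟨k - 1, by omega⟩
  rw [Finset.sum_range_succ', Finset.sum_range_succ']
  have hsum := one_sub_sq_mul_sum (-expSubOne) N
  have hexp : 1 - -expSubOne = PowerSeries.exp ℝ := by simp [expSubOne]
  rw [hexp] at hsum
  have hX : (PowerSeries.X : PowerSeries ℝ) ^ N ∣ (-expSubOne) ^ N :=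
    pow_dvd_pow_of_dvd (X_dvd_expSubOne.neg_right) N
  have key : PowerSeries.coeff (N + 1) (PowerSeries.X ^ 2 * (PowerSeries.exp ℝ ^ 2 *
      ∑ i ∈ Finset.range N, ((i : PowerSeries ℝ) + 1) * (-expSubOne) ^ i)) = 0 := by
    obtain ⟨g, hg⟩ := hX
    have : (PowerSeries.X : PowerSeries ℝ) ^ 2 *
        (1 - ((N : PowerSeries ℝ) + 1) * (-expSubOne) ^ N + (N : PowerSeries ℝ) * (-expSubOne) ^ (N + 1)) =
        PowerSeries.X ^ 2 +
          PowerSeries.X ^ (N + 2) * (-((N : PowerSeries ℝ) + 1) * g + (N : PowerSeries ℝ) * g * (-expSubOne)) := by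
      rw [pow_succ (-expSubOne), hg]; ring
    rw [hsum, this, map_add, PowerSeries.coeff_X_pow, PowerSeries.coeff_X_pow_mul',
      if_neg (by omega), if_neg (by omega), add_zero]
  rw [← mul_assoc, ← mul_pow, Finset.mul_sum, map_sum] at key
  rw [← neg_eq_zero, ← key]
  simp only [zero_add, Nat.sub_self, mul_zero, Nat.cast_zero, zero_mul, add_zero]
  rw [← Finset.sum_neg_distrib]
  refine Finset.sum_congr rfl fun i _ => ?_
  have h1 : (PowerSeries.X * PowerSeries.exp ℝ) ^ 2 *
      (((i : PowerSeries ℝ) + 1) * (-expSubOne) ^ i) =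
      PowerSeries.C ((i + 1) * (-1) ^ i : ℝ) *
        ((PowerSeries.X * PowerSeries.exp ℝ) ^ 2 * expSubOne ^ i) := by
    rw [neg_pow]; simp; ring
  rw [h1, PowerSeries.coeff_C_mul]
  have : ((i : ℝ) + 1 + 1) ≠ 0 := by positivity
  simp only [Nat.add_sub_cancel, show i + 1 + 1 - 2 = i by omega]
  push_cast
  field_simp
  ring

lemma sum_composition_eq_sum_finsuppAntidiag {M : Type*} [AddCommMonoid M] (k : ℕ)
    (W : (n : ℕ) → (Fin n → ℕ) → M)
    (hW : ∀ (n : ℕ) (φ : Fin n → ℕ) (i : Fin n), φ i = 0 → W n φ = 0) :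
    ∑ c : Composition k, W c.length c.blocksFun =
      ∑ n ∈ Finset.range (k + 1),
        ∑ φ ∈ Finset.finsuppAntidiag (Finset.univ : Finset (Fin n)) k, W n φ := by
  rw [Finset.sum_sigma']
  refine Finset.sum_of_injOn
    (fun c => ⟨c.length, Finsupp.equivFunOnFinite.symm c.blocksFun⟩) ?_ ?_ ?_ ?_
  · intro c _ d _ h
    have h' := congrArg (fun s : (n : ℕ) × (Fin n →₀ ℕ) => List.ofFn (s.2 : Fin s.1 → ℕ)) h
    change List.ofFn c.blocksFun = List.ofFn d.blocksFun at h'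
    rw [Composition.ofFn_blocksFun, Composition.ofFn_blocksFun] at h'
    exact Composition.ext h'
  · intro c _
    simp [Finset.mem_finsuppAntidiag, c.length_le, c.sum_blocksFun]
  · rintro ⟨n, φ⟩ hmem hnot
    by_contra hne
    have hpos : ∀ i, φ i ≠ 0 := fun i hi => hne (hW n φ i hi)
    simp only [Finset.mem_sigma, Finset.mem_finsuppAntidiag] at hmem
    let c : Composition k := ⟨List.ofFn φ, by
      intro a ha
      obtain ⟨i, rfl⟩ := (List.mem_ofFn' _ _).1 ha
      exact Nat.pos_of_ne_zero (hpos i), by rw [List.sum_ofFn]; exact hmem.2.1⟩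
    refine hnot ⟨c, by simp, ?_⟩
    have h := List.equivSigmaTuple.apply_symm_apply ⟨n, (φ : Fin n → ℕ)⟩
    exact congrArg (fun s : (n : ℕ) × (Fin n → ℕ) =>
      (⟨s.1, Finsupp.equivFunOnFinite.symm s.2⟩ : (n : ℕ) × (Fin n →₀ ℕ))) h |>.trans (by simp)
  · intro c _
    simp

lemma sum_composition_offdiag_eq_zero {k : ℕ} (hk : 3 ≤ k) :
    ∑ c : Composition k,
      ((-1 : ℝ) ^ (c.length - 1) / (c.length : ℝ)) *
        ((Nat.factorial k : ℝ) / ∏ i : Fin c.length, (Nat.factorial (c.blocksFun i) : ℝ)) *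
        ∑ p ∈ Finset.univ.filter (fun p : Fin c.length × Fin c.length => p.1 ≠ p.2),
          (c.blocksFun p.1 : ℝ) * (c.blocksFun p.2 : ℝ) = 0 := by
  let W : (n : ℕ) → (Fin n → ℕ) → ℝ := fun n φ => ((-1 : ℝ) ^ (n - 1) / n) *
    ((∏ i, PowerSeries.coeff (φ i) expSubOne) *
      ∑ p ∈ Finset.univ.filter (fun p : Fin n × Fin n => p.1 ≠ p.2), (φ p.1 : ℝ) * (φ p.2 : ℝ))
  have hW : ∀ (n : ℕ) (φ : Fin n → ℕ) (i : Fin n), φ i = 0 → W n φ = 0 := by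
    intro n φ i hi
    have : ∏ i, PowerSeries.coeff (φ i) expSubOne = 0 :=
      Finset.prod_eq_zero (Finset.mem_univ i) (by rw [hi, coeff_expSubOne, if_pos rfl])
    simp [W, this]
  have h := sum_composition_eq_sum_finsuppAntidiag k W hW
  have h0 : ∑ n ∈ Finset.range (k + 1),
      ∑ φ ∈ Finset.finsuppAntidiag (Finset.univ : Finset (Fin n)) k, W n φ = 0 := by
    rw [← sum_coeff_eq_zero hk]
    refine Finset.sum_congr rfl fun n _ => ?_
    simp only [W, ← Finset.mul_sum]
    congr 1
    simp only [Finset.mul_sum]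
    rw [Finset.sum_comm, Finset.sum_congr rfl fun p hp =>
      sum_finsuppAntidiag_mul_pair n k (Finset.mem_filter.1 hp).2, Finset.sum_const,
      card_filter_fst_ne_snd, nsmul_eq_mul]
  rw [h0] at h
  rw [← mul_zero (k.factorial : ℝ), ← h, Finset.mul_sum]
  refine Finset.sum_congr rfl fun c _ => ?_
  have hc : ∏ i, PowerSeries.coeff (c.blocksFun i) expSubOne =
      (∏ i : Fin c.length, (Nat.factorial (c.blocksFun i) : ℝ))⁻¹ := by
    rw [← Finset.prod_inv_distrib]
    refine Finset.prod_congr rfl fun i _ => ?_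
    rw [coeff_expSubOne, if_neg (Nat.one_le_iff_ne_zero.1 (c.one_le_blocksFun i))]
  simp only [W, hc]
  ring

lemma fderiv_prod_apply_single {ι : Type*} [Fintype ι] [DecidableEq ι] {h : ι → ℂ → ℝ}
    (hd : ∀ i, Differentiable ℝ (h i)) (z : ι → ℂ) (r : ι) (v : ℂ) :
    fderiv ℝ (fun z : ι → ℂ => ∏ i, h i (z i)) z (Pi.single r v) =
      ∏ i, Function.update h r (fun w => fderiv ℝ (h r) w v) i (z i) := by
  have h1 : ∀ i ∈ Finset.univ, HasFDerivAt (fun z : ι → ℂ => h i (z i))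
      ((fderiv ℝ (h i) (z i)).comp (ContinuousLinearMap.proj (R := ℝ) (φ := fun _ : ι => ℂ) i))
      z := fun i _ =>
    HasFDerivAt.comp z (hd i (z i)).hasFDerivAt (hasFDerivAt_apply i z)
  rw [(HasFDerivAt.finsetProd h1).fderiv, sum_apply,
    Finset.sum_eq_single r]
  · rw [← Finset.mul_prod_erase _ _ (Finset.mem_univ r)]
    simp only [Function.update_self, smul_apply,
      ContinuousLinearMap.comp_apply, ContinuousLinearMap.proj_apply, Pi.single_eq_same,
      smul_eq_mul]
    rw [mul_comm]
    congr 1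
    refine Finset.prod_congr rfl fun i hi => ?_
    rw [Function.update_of_ne (Finset.ne_of_mem_erase hi)]
  · intro i _ hi
    simp [hi]
  · simp

lemma fderiv_fderiv_prod_apply_single {ι : Type*} [Fintype ι] [DecidableEq ι] {h : ι → ℂ → ℝ}
    (hd : ∀ i, ContDiff ℝ 2 (h i)) (z : ι → ℂ) {r s : ι} (hrs : r ≠ s) (v w : ℂ) :
    fderiv ℝ (fun z => fderiv ℝ (fun z : ι → ℂ => ∏ i, h i (z i)) z (Pi.single s w)) z
        (Pi.single r v) =
      fderiv ℝ (h r) (z r) v * fderiv ℝ (h s) (z s) w *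
        ∏ i ∈ (Finset.univ.erase r).erase s, h i (z i) := by
  have hd1 : ∀ i, Differentiable ℝ (h i) := fun i => (hd i).differentiable (by norm_num)
  simp only [fderiv_prod_apply_single hd1]
  rw [fderiv_prod_apply_single]
  · rw [← Finset.mul_prod_erase _ _ (Finset.mem_univ r), Function.update_self,
      Function.update_of_ne hrs, ← Finset.mul_prod_erase _ _
      (Finset.mem_erase.2 ⟨hrs.symm, Finset.mem_univ s⟩), Function.update_of_ne hrs.symm,
      Function.update_self, ← mul_assoc]
    congr 1
    refine Finset.prod_congr rfl fun i hi => ?_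
    simp only [Finset.mem_erase] at hi
    rw [Function.update_of_ne hi.2.1, Function.update_of_ne hi.1]
  · intro i
    by_cases hi : i = s
    · subst hi
      rw [Function.update_self]
      exact (((hd i).fderiv_right (m := 1) (by norm_num)).differentiable (by norm_num)).clm_apply
        (differentiable_const w)
    · rw [Function.update_of_ne hi]
      exact hd1 i

lemma fderiv_fderiv_prod_pow_apply_single {ι : Type*} [Fintype ι] [DecidableEq ι] {f : ℂ → ℝ}
    (hf : ContDiff ℝ 2 f) (e : ι → ℕ) (z0 : ℂ) {r s : ι} (hrs : r ≠ s) (v w : ℂ) :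
    fderiv ℝ (fun z => fderiv ℝ (fun z : ι → ℂ => ∏ i, f (z i) ^ e i) z (Pi.single s w))
        (fun _ => z0) (Pi.single r v) =
      (e r * e s) * (f z0 ^ ((∑ i, e i) - 2) * fderiv ℝ f z0 v * fderiv ℝ f z0 w) := by
  rw [fderiv_fderiv_prod_apply_single (h := fun i z => f z ^ e i) (fun i => hf.pow _) _ hrs]
  have hd : DifferentiableAt ℝ f z0 := hf.differentiable (by norm_num) z0
  rw [fderiv_fun_pow _ hd, fderiv_fun_pow _ hd, Finset.prod_pow_eq_pow_sum,
    ← Finset.add_sum_erase _ _ (Finset.mem_univ r), ← Finset.add_sum_erase _ _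
      (Finset.mem_erase.2 ⟨hrs.symm, Finset.mem_univ s⟩)]
  simp only [smul_apply, smul_eq_mul, nsmul_eq_mul]
  rcases Nat.eq_zero_or_pos (e r) with hr | hr
  · simp [hr]
  rcases Nat.eq_zero_or_pos (e s) with hs | hs
  · simp [hs]
  set S := ∑ i ∈ (Finset.univ.erase r).erase s, e i
  rw [show e r + (e s + S) - 2 = (e r - 1) + (e s - 1) + S by omega, pow_add, pow_add]
  ring

/-- The blocks of a composition of `k`, padded by zeros to a function on `Fin k`. -/
def paddedBlocks {k : ℕ} (c : Composition k) (r : Fin k) : ℕ :=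
  if h : (r : ℕ) < c.length then c.blocksFun ⟨r, h⟩ else 0

lemma paddedBlocks_castLE {k : ℕ} (c : Composition k) (i : Fin c.length) :
    paddedBlocks c (Fin.castLE c.length_le i) = c.blocksFun i := by
  simp [paddedBlocks]

lemma paddedBlocks_of_notMem_range {k : ℕ} (c : Composition k) {r : Fin k}
    (hr : r ∉ Set.range (Fin.castLE c.length_le)) : paddedBlocks c r = 0 := by
  rw [paddedBlocks, dif_neg]
  exact fun h => hr ⟨⟨r, h⟩, rfl⟩

lemma sum_paddedBlocks {k : ℕ} (c : Composition k) : ∑ r, paddedBlocks c r = k := by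
  rw [← Fintype.sum_of_injective _ (Fin.castLE_injective c.length_le) c.blocksFun _
    (fun _ h => paddedBlocks_of_notMem_range c h) (fun i => (paddedBlocks_castLE c i).symm),
    c.sum_blocksFun]

lemma prod_pow_blocksFun {k : ℕ} (c : Composition k) (f : ℂ → ℝ) (z : Fin k → ℂ) :
    ∏ i : Fin c.length, f (z (Fin.castLE c.length_le i)) ^ (c.blocksFun i) =
      ∏ r, f (z r) ^ paddedBlocks c r := by
  refine Fintype.prod_of_injective _ (Fin.castLE_injective c.length_le) _ _ ?_ ?_
  · intro r hr
    rw [paddedBlocks_of_notMem_range c hr, pow_zero]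
  · intro i
    rw [paddedBlocks_castLE]

lemma sum_filter_ne_paddedBlocks {k : ℕ} (c : Composition k) :
    ∑ p ∈ Finset.univ.filter (fun p : Fin k × Fin k => p.1 ≠ p.2),
      (paddedBlocks c p.1 : ℝ) * (paddedBlocks c p.2 : ℝ) =
    ∑ p ∈ Finset.univ.filter (fun p : Fin c.length × Fin c.length => p.1 ≠ p.2),
      (c.blocksFun p.1 : ℝ) * (c.blocksFun p.2 : ℝ) := by
  have hinj := Fin.castLE_injective c.length_le
  symm
  refine Finset.sum_of_injOn (Prod.map (Fin.castLE c.length_le) (Fin.castLE c.length_le))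
    (hinj.prodMap hinj).injOn ?_ ?_ ?_
  · intro p hp
    simpa using hp
  · rintro ⟨r, s⟩ hrs hnot
    by_cases hr : r ∈ Set.range (Fin.castLE c.length_le)
    · by_cases hs : s ∈ Set.range (Fin.castLE c.length_le)
      · obtain ⟨i, rfl⟩ := hr
        obtain ⟨j, rfl⟩ := hs
        exact absurd ⟨(i, j), by simpa using hrs, rfl⟩ hnot
      · simp [paddedBlocks_of_notMem_range c hs]
    · simp [paddedBlocks_of_notMem_range c hr]
  · intro p _
    simp [paddedBlocks_castLE]

lemma fderiv_fderiv_cumulantG {f : ℂ → ℝ} (hf : ContDiff ℝ 2 f) (k : ℕ) (z v w : Fin k → ℂ) :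
    fderiv ℝ (fun z => fderiv ℝ (cumulantG f k) z w) z v =
      ∑ c : Composition k,
        ((-1 : ℝ) ^ (c.length - 1) / (c.length : ℝ)) *
          ((Nat.factorial k : ℝ) / ∏ i : Fin c.length, (Nat.factorial (c.blocksFun i) : ℝ)) *
          fderiv ℝ (fun z => fderiv ℝ (fun z => ∏ r, f (z r) ^ paddedBlocks c r) z w) z v := by
  have hC : ∀ c : Composition k, ContDiff ℝ 2
      (fun z : Fin k → ℂ => ∏ r, f (z r) ^ paddedBlocks c r) := fun c =>
    contDiff_prod fun r _ => (hf.comp (contDiff_apply ℝ ℂ r)).pow _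
  have hD : ∀ c : Composition k, Differentiable ℝ
      (fun z : Fin k → ℂ => ∏ r, f (z r) ^ paddedBlocks c r) := fun c =>
    (hC c).differentiable (by norm_num)
  have hD' : ∀ c : Composition k, Differentiable ℝ
      (fun z => fderiv ℝ (fun z : Fin k → ℂ => ∏ r, f (z r) ^ paddedBlocks c r) z w) := fun c =>
    (((hC c).fderiv_right (m := 1) (by norm_num)).differentiable (by norm_num)).clm_apply
      (differentiable_const w)
  have hG : cumulantG f k = fun z => ∑ c : Composition k,
      ((-1 : ℝ) ^ (c.length - 1) / (c.length : ℝ)) *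
        ((Nat.factorial k : ℝ) / ∏ i : Fin c.length, (Nat.factorial (c.blocksFun i) : ℝ)) *
        ∏ r, f (z r) ^ paddedBlocks c r := by
    funext z
    simp only [cumulantG, prod_pow_blocksFun]
  have h1 : ∀ z, fderiv ℝ (cumulantG f k) z w = ∑ c : Composition k,
      ((-1 : ℝ) ^ (c.length - 1) / (c.length : ℝ)) *
        ((Nat.factorial k : ℝ) / ∏ i : Fin c.length, (Nat.factorial (c.blocksFun i) : ℝ)) *
        fderiv ℝ (fun z => ∏ r, f (z r) ^ paddedBlocks c r) z w := by
    intro z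
    rw [hG, fderiv_fun_sum fun c _ => ((hD c) z).const_mul _, sum_apply]
    refine Finset.sum_congr rfl fun c _ => ?_
    rw [fderiv_const_mul (hD c z), smul_apply, smul_eq_mul]
  simp only [h1]
  rw [fderiv_fun_sum fun c _ => ((hD' c) z).const_mul _, sum_apply]
  refine Finset.sum_congr rfl fun c _ => ?_
  rw [fderiv_const_mul (hD' c z), smul_apply, smul_eq_mul]

/-- for `f` of class `C²`, `k ≥ 3`, `z_0 ∈ ℂ` and `m, l ∈ {1,2}`,
`Σ_{1 ≤ r_1 ≠ r_2 ≤ k} (∂_{r_1 m} ∂_{r_2 l} G_k)(z_0,…,z_0) = 0`. -/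
theorem cumulantG_diag_second_deriv_offdiag_sum (f : ℂ → ℝ) (hf : ContDiff ℝ 2 f)
    (k : ℕ) (hk : 3 ≤ k) (z0 : ℂ) (m l : Fin 2) :
    ∑ p ∈ Finset.univ.filter (fun p : Fin k × Fin k => p.1 ≠ p.2),
      fderiv ℝ (fun z => fderiv ℝ (cumulantG f k) z (coordDir k p.2 l))
        (fun _ => z0) (coordDir k p.1 m) = 0 := by
  simp only [fderiv_fderiv_cumulantG hf]
  rw [Finset.sum_comm, ← zero_mul (f z0 ^ (k - 2) *
    fderiv ℝ f z0 (if m = 0 then (1 : ℂ) else Complex.I) *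
    fderiv ℝ f z0 (if l = 0 then (1 : ℂ) else Complex.I)),
    ← sum_composition_offdiag_eq_zero hk, Finset.sum_mul]
  refine Finset.sum_congr rfl fun c _ => ?_
  rw [← Finset.mul_sum, ← sum_filter_ne_paddedBlocks, mul_assoc _ (Finset.sum _ _),
    Finset.sum_mul]
  congr 1
  refine Finset.sum_congr rfl fun p hp => ?_
  rw [coordDir, coordDir, fderiv_fderiv_prod_pow_apply_single hf _ _ (Finset.mem_filter.1 hp).2,
    sum_paddedBlocks]
end

section
/- Let K : ℂ×ℂ → ℂ be continuous Hermitian symmetric with |K(z,w)| = φ(z−w), φ bounded continuous, inducing a bounded positive integral operator T_K on L²(ℂ) with spectrum in [0,1], and suppose T_K ≠ T_K². Then φ(0) − ∫_ℂ φ² dA ≠ 0, in fact φ(0) > ∫_ℂ φ² dA. -/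
open MeasureTheory
open scoped ComplexOrder
open Filter Topology Metric
open scoped InnerProductSpace ENNReal

/-- A positive operator whose spectrum lies in `[0, 1]` dominates its square; the difference is
therefore of the form `star s * s`. -/
lemma exists_sub_comp_self_eq_star_mul_self {H : Type*} [NormedAddCommGroup H]
    [InnerProductSpace ℂ H] [CompleteSpace H] (T : H →L[ℂ] H) (hT : T.IsPositive)
    (hspec : spectrum ℂ T ⊆ Set.Icc (0 : ℂ) 1) :
    ∃ s : H →L[ℂ] H, T - T ∘L T = star s * s := by
  rw [← CStarAlgebra.nonneg_iff_eq_star_mul_self]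
  have hn : IsStarNormal T := hT.isSelfAdjoint.isStarNormal
  have h : cfc (fun x : ℂ => x - x * x) T = T - T ∘L T := by
    rw [cfc_sub (fun x : ℂ => x) (fun x : ℂ => x * x) T,
      cfc_mul (fun x : ℂ => x) (fun x : ℂ => x) T, cfc_id' ℂ T]
    rfl
  rw [← h]
  refine cfc_nonneg fun x hx => ?_
  obtain ⟨h0, h1⟩ := hspec hx
  have : x - x * x = x * (1 - x) := by ring
  rw [this]
  exact mul_nonneg h0 (sub_nonneg.2 h1)

/-- The indicator of a closed disc, normalised to have integral `1`, as an element of `L²`. -/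
noncomputable def discAverage (z : ℂ) (r : ℝ) : Lp ℂ 2 (volume : Measure ℂ) :=
  indicatorConstLp 2 (measurableSet_closedBall (x := z) (ε := r))
    measure_closedBall_lt_top.ne (((volume.real (closedBall z r))⁻¹ : ℝ) : ℂ)

lemma inner_discAverage (z : ℂ) (r : ℝ) (f : Lp ℂ 2 (volume : Measure ℂ)) :
    ⟪discAverage z r, f⟫_ℂ = ⨍ x in closedBall z r, f x := by
  rw [discAverage, L2.inner_indicatorConstLp_eq_inner_setIntegral, setAverage_eq]
  simp [mul_comm]

lemma integral_mul_discAverage (z : ℂ) (r : ℝ) (f : ℂ → ℂ) :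
    ∫ w, f w * discAverage z r w = ⨍ w in closedBall z r, f w := by
  have h : (fun w => f w * discAverage z r w) =ᵐ[volume]
      (closedBall z r).indicator fun w => (volume.real (closedBall z r))⁻¹ • f w := by
    filter_upwards [indicatorConstLp_coeFn (p := 2) (μ := volume)
      (hs := measurableSet_closedBall (x := z) (ε := r))
      (hμs := measure_closedBall_lt_top.ne)
      (c := (((volume.real (closedBall z r))⁻¹ : ℝ) : ℂ))] with w hw
    rw [discAverage, hw]
    by_cases hm : w ∈ closedBall z r
    · simp [hm, mul_comm]
    · simp [hm]
  rw [integral_congr_ae h, integral_indicator measurableSet_closedBall, integral_smul,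
    setAverage_eq]

/-- The average over a disc lies in every closed ball containing almost all values. -/
lemma setAverage_mem_closedBall {f : ℂ → ℂ} {z c : ℂ} {r ε : ℝ} (hr : 0 < r)
    (hf : IntegrableOn f (closedBall z r))
    (h : ∀ᵐ w : ℂ, w ∈ closedBall z r → f w ∈ closedBall c ε) :
    ⨍ w in closedBall z r, f w ∈ closedBall c ε :=
  (convex_closedBall c ε).set_average_mem isClosed_closedBall
    (measure_closedBall_pos volume z hr).ne' measure_closedBall_lt_top.ne
    ((ae_restrict_iff' measurableSet_closedBall).2 h) hf

lemma tendsto_setAverage_closedBall {f : ℂ → ℂ} (hf : Continuous f) (z : ℂ) :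
    Tendsto (fun r => ⨍ w in closedBall z r, f w) (𝓝[>] 0) (𝓝 (f z)) := by
  rw [Metric.nhds_basis_closedBall.tendsto_right_iff]
  intro ε hε
  obtain ⟨d, hd, h⟩ := Metric.continuous_iff.1 hf z ε hε
  filter_upwards [Ioo_mem_nhdsGT hd] with r hr
  refine setAverage_mem_closedBall hr.1
    (hf.continuousOn.integrableOn_compact (isCompact_closedBall z r)) (.of_forall fun w hw => ?_)
  exact (h w ((mem_closedBall.1 hw).trans_lt hr.2)).le

lemma enorm_sq_eq_lintegral (f : Lp ℂ 2 (volume : Measure ℂ)) :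
    ‖f‖ₑ ^ 2 = ∫⁻ x, ‖f x‖ₑ ^ 2 := by
  have := eLpNorm_nnreal_pow_eq_lintegral (f := f) (μ := volume) (p := 2) two_ne_zero
  simpa [Lp.enorm_def] using this

section Kernel

variable {K : ℂ → ℂ → ℂ} {φ : ℂ → ℝ}
  {T : Lp ℂ 2 (volume : Measure ℂ) →L[ℂ] Lp ℂ 2 (volume : Measure ℂ)}

lemma kernel_apply_discAverage
    (hT : ∀ g : Lp ℂ 2 (volume : Measure ℂ),
      ∀ᵐ z : ℂ, (T g : ℂ → ℂ) z = ∫ w, K z w * g w) (z : ℂ) (r : ℝ) :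
    T (discAverage z r) =ᵐ[volume] fun x => ⨍ w in closedBall z r, K x w := by
  filter_upwards [hT (discAverage z r)] with x hx
  rw [hx, integral_mul_discAverage]

lemma eventually_lt_norm_apply_discAverage_sq
    (hKcont : Continuous fun p : ℂ × ℂ => K p.1 p.2) (habs : ∀ z w, ‖K z w‖ = φ (z - w))
    (hφ2 : Integrable fun z => φ z ^ 2)
    (hT : ∀ g : Lp ℂ 2 (volume : Measure ℂ),
      ∀ᵐ z : ℂ, (T g : ℂ → ℂ) z = ∫ w, K z w * g w) (z : ℂ) {ε : ℝ} (hε : 0 < ε) :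
    ∀ᶠ r in 𝓝[>] (0 : ℝ), (∫ x, φ x ^ 2) - ε < ‖T (discAverage z r)‖ ^ 2 := by
  by_cases hS : (∫ x, φ x ^ 2) - ε < 0
  · exact .of_forall fun r => hS.trans_le (sq_nonneg _)
  have hfatou : ENNReal.ofReal (∫ x, φ x ^ 2) ≤
      liminf (fun r => ‖T (discAverage z r)‖ₑ ^ 2) (𝓝[>] (0 : ℝ)) := by
    calc ENNReal.ofReal (∫ x, φ x ^ 2)
        = ∫⁻ x, ENNReal.ofReal (φ (x - z) ^ 2) := by
          rw [ofReal_integral_eq_lintegral_ofReal hφ2 (.of_forall fun x => sq_nonneg _),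
            lintegral_sub_right_eq_self (fun x => ENNReal.ofReal (φ x ^ 2)) z]
      _ = ∫⁻ x, liminf (fun r => ‖⨍ w in closedBall z r, K x w‖ₑ ^ 2) (𝓝[>] (0 : ℝ)) := by
          refine lintegral_congr fun x => ?_
          have hx : Continuous (K x) := hKcont.comp (.prodMk_right x)
          have := (ENNReal.continuous_pow 2).continuousAt.tendsto.comp
            (tendsto_setAverage_closedBall hx z).enorm
          rw [← habs, ENNReal.ofReal_pow (norm_nonneg _), ofReal_norm]
          exact this.liminf_eq.symm
      _ ≤ liminf (fun r => ∫⁻ x, ‖⨍ w in closedBall z r, K x w‖ₑ ^ 2) (𝓝[>] (0 : ℝ)) :=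
          lintegral_liminf_le' fun r =>
            (((Lp.aestronglyMeasurable (T (discAverage z r))).congr
              (kernel_apply_discAverage hT z r)).enorm.pow_const 2)
      _ = _ := by
          congr 1
          ext r
          rw [enorm_sq_eq_lintegral]
          refine lintegral_congr_ae ?_
          filter_upwards [kernel_apply_discAverage hT z r] with x hx
          rw [hx]
  have hlt : ENNReal.ofReal ((∫ x, φ x ^ 2) - ε) < ENNReal.ofReal (∫ x, φ x ^ 2) :=
    (ENNReal.ofReal_lt_ofReal_iff (by linarith)).2 (by linarith)
  filter_upwards [eventually_lt_of_lt_liminf (hlt.trans_le hfatou)] with r hr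
  rw [← ofReal_norm, ← ENNReal.ofReal_pow (norm_nonneg _)] at hr
  exact (ENNReal.ofReal_lt_ofReal_iff'.1 hr).1

lemma eventually_norm_inner_discAverage_le
    (hKcont : Continuous fun p : ℂ × ℂ => K p.1 p.2) (habs : ∀ z w, ‖K z w‖ = φ (z - w))
    (hφc : Continuous φ)
    (hT : ∀ g : Lp ℂ 2 (volume : Measure ℂ),
      ∀ᵐ z : ℂ, (T g : ℂ → ℂ) z = ∫ w, K z w * g w) (z : ℂ) {ε : ℝ} (hε : 0 < ε) :
    ∀ᶠ r in 𝓝[>] (0 : ℝ), ‖⟪discAverage z r, T (discAverage z r)⟫_ℂ‖ ≤ φ 0 + ε := by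
  obtain ⟨d, hd, h⟩ := Metric.continuous_iff.1 hφc 0 ε hε
  filter_upwards [Ioo_mem_nhdsGT (half_pos hd)] with r hr
  rw [inner_discAverage, ← mem_closedBall_zero_iff]
  refine setAverage_mem_closedBall hr.1 (integrableOn_Lp_of_measure_ne_top _
    fact_one_le_two_ennreal.elim measure_closedBall_lt_top.ne) ?_
  filter_upwards [kernel_apply_discAverage hT z r] with x hx hxr
  rw [hx]
  have hKx : Continuous (K x) := hKcont.comp (.prodMk_right x)
  refine setAverage_mem_closedBall hr.1
    (hKx.continuousOn.integrableOn_compact (isCompact_closedBall z r)) (.of_forall fun w hw => ?_)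
  rw [mem_closedBall_zero_iff, habs]
  have hxw : dist (x - w) 0 < d := by
    rw [dist_zero_right, ← dist_eq_norm]
    have := dist_triangle_right x w z
    rw [mem_closedBall] at hxr hw
    linarith [hr.2]
  have := (abs_lt.1 (Real.dist_eq _ _ ▸ h _ hxw)).2
  linarith

end Kernel

/-- let `K : ℂ×ℂ → ℂ` be a continuous Hermitian symmetric kernel with
`|K(z,w)| = φ(z−w)` for a bounded continuous `φ ≥ 0` with `φ² ∈ L¹`, inducing a bounded
positive integral operator `T_K` on `L²(ℂ)` with spectrum in `[0,1]`.  If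
`T_K ≠ T_K²`, then `φ(0) − ∫ φ² dA ≠ 0`; in fact `φ(0) > ∫ φ² dA`. -/
theorem non_reproducing_kernel_diag_gap
    (K : ℂ → ℂ → ℂ) (φ : ℂ → ℝ)
    (hKcont : Continuous fun p : ℂ × ℂ => K p.1 p.2)
    (hherm : ∀ z w, K z w = starRingEnd ℂ (K w z))
    (habs : ∀ z w, ‖K z w‖ = φ (z - w))
    (hφc : Continuous φ) (hφ0 : ∀ z, 0 ≤ φ z) (hφb : ∃ M, ∀ z, φ z ≤ M)
    (hφ2 : Integrable fun z => φ z ^ 2)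
    (T : Lp ℂ 2 (volume : Measure ℂ) →L[ℂ] Lp ℂ 2 (volume : Measure ℂ))
    (hT : ∀ g : Lp ℂ 2 (volume : Measure ℂ),
      ∀ᵐ z : ℂ, (T g : ℂ → ℂ) z = ∫ w, K z w * g w)
    (hTpos : T.IsPositive)
    (hspec : spectrum ℂ T ⊆ Set.Icc (0 : ℂ) 1)
    (hne : T ≠ T ∘L T) :
    ∫ z, φ z ^ 2 < φ 0 := by
  by_contra! hle
  apply hne
  obtain ⟨s, hs⟩ := exists_sub_comp_self_eq_star_mul_self T hTpos hspec
  have hinner (f g : Lp ℂ 2 (volume : Measure ℂ)) :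
      ⟪f, (T - T ∘L T) g⟫_ℂ = ⟪s f, s g⟫_ℂ := by
    rw [hs, mul_apply_eq_comp, ContinuousLinearMap.star_eq_adjoint,
      ContinuousLinearMap.adjoint_inner_right]
  have hnorm (f : Lp ℂ 2 (volume : Measure ℂ)) : ‖s f‖ ^ 2 ≤ ‖⟪f, T f⟫_ℂ‖ - ‖T f‖ ^ 2 := by
    have h1 : ⟪f, T (T f)⟫_ℂ = ⟪T f, T f⟫_ℂ := (hTpos.isSymmetric f (T f)).symm
    have h2 := hinner f f
    rw [sub_apply, ContinuousLinearMap.comp_apply, inner_sub_right,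
      h1] at h2
    have h3 := congrArg RCLike.re h2
    rw [map_sub, inner_self_eq_norm_sq, inner_self_eq_norm_sq] at h3
    have h4 := RCLike.re_le_norm ⟪f, T f⟫_ℂ
    linarith
  have hlim (z : ℂ) : Tendsto (fun r => s (discAverage z r)) (𝓝[>] (0 : ℝ)) (𝓝 0) := by
    have hsq : Tendsto (fun r => ‖s (discAverage z r)‖ ^ 2) (𝓝[>] (0 : ℝ)) (𝓝 0) := by
      rw [Metric.nhds_basis_closedBall.tendsto_right_iff]
      intro ε hε
      filter_upwards [eventually_lt_norm_apply_discAverage_sq hKcont habs hφ2 hT z (half_pos hε),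
        eventually_norm_inner_discAverage_le hKcont habs hφc hT z (half_pos hε)] with r h1 h2
      rw [mem_closedBall_zero_iff, Real.norm_of_nonneg (sq_nonneg _)]
      linarith [hnorm (discAverage z r)]
    rw [tendsto_zero_iff_norm_tendsto_zero]
    simpa using hsq.sqrt
  rw [← sub_eq_zero]
  ext1 g
  rw [zero_apply, Lp.eq_zero_iff_ae_eq_zero]
  have hloc : LocallyIntegrable (((T - T ∘L T) g : Lp ℂ 2 volume) : ℂ → ℂ) :=
    (Lp.memLp _).locallyIntegrable fact_one_le_two_ennreal.elim
  filter_upwards [(Besicovitch.vitaliFamily (volume : Measure ℂ)).ae_tendsto_average hloc] with z hz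
  refine tendsto_nhds_unique (hz.comp (Besicovitch.tendsto_filterAt volume z)) ?_
  have h := (hlim z).inner (tendsto_const_nhds (x := s g)) (𝕜 := ℂ)
  simp only [← hinner, inner_discAverage, inner_zero_left] at h
  exact h
end

section
/- Let X be a DPP on ℂ with kernel K_ρ(z,w) = ρK(√ρz, √ρw) where |K(z,w)| = φ(z−w), φ bounded continuous, T_K has spectrum in [0,1] but is not a projection. Then for every non-zero compactly supported C³ function f : ℂ → ℝ, liminf_{ρ→∞} ρ^{-1} Var[Tr_ρ(f)] > 0. -/
open MeasureTheory
open scoped ComplexOrder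

open Filter Topology

/-- A positive operator whose spectrum lies in `[0, 1]` dominates its square. -/
lemma nonneg_sub_comp_self {H : Type*} [NormedAddCommGroup H] [InnerProductSpace ℂ H]
    [CompleteSpace H] {T : H →L[ℂ] H} (hT : T.IsPositive)
    (hspec : spectrum ℂ T ⊆ Set.Icc (0 : ℂ) 1) : 0 ≤ T - T ∘L T := by
  have hn : IsStarNormal T := hT.isSelfAdjoint.isStarNormal
  have h : cfc (fun x : ℂ => x - x ^ 2) T = T - T ∘L T := by
    rw [cfc_sub .., cfc_pow_id .., cfc_id' .., pow_two]; rfl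
  rw [← h]
  refine cfc_nonneg fun x hx => ?_
  obtain ⟨h0, h1⟩ := hspec hx
  rw [show x - x ^ 2 = x * (1 - x) by ring]
  exact mul_nonneg h0 (sub_nonneg.2 h1)

/-- Every nonnegative operator is of the form `S† S`. -/
lemma exists_inner_eq_of_nonneg {H : Type*} [NormedAddCommGroup H] [InnerProductSpace ℂ H]
    [CompleteSpace H] {Q : H →L[ℂ] H} (hQ : 0 ≤ Q) :
    ∃ S : H →L[ℂ] H, ∀ x y, inner ℂ (S x) (S y) = inner ℂ x (Q y) := by
  obtain ⟨S, rfl⟩ := CStarAlgebra.nonneg_iff_eq_star_mul_self.1 hQ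
  exact ⟨S, fun x y => (ContinuousLinearMap.adjoint_inner_right S x (S y)).symm⟩

lemma enorm_Lp_two_sq {α : Type*} [MeasurableSpace α] {μ : Measure α} (g : Lp ℂ 2 μ) :
    ‖g‖ₑ ^ 2 = ∫⁻ x, ‖g x‖ₑ ^ 2 ∂μ := by
  have h := eLpNorm_nnreal_pow_eq_lintegral (f := g) (μ := μ) (p := 2) two_ne_zero
  rw [Lp.enorm_def]
  simpa using h

lemma dist_setAverage_le {α : Type*} [MeasurableSpace α] {μ : Measure α} {t : Set α}
    {F : α → ℂ} {c : ℂ} {η : ℝ} (h0 : μ t ≠ 0) (ht : μ t ≠ ⊤)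
    (hF : ∀ᵐ x ∂μ.restrict t, dist (F x) c ≤ η) (hint : IntegrableOn F t μ) :
    dist (⨍ x in t, F x ∂μ) c ≤ η :=
  (convex_closedBall c η).set_average_mem Metric.isClosed_closedBall h0 ht hF hint

/-- The indicator function of a closed disc, normalized to have integral one. -/
noncomputable def normalizedDisc (z : ℂ) (r : ℝ) : Lp ℂ 2 (volume : Measure ℂ) :=
  indicatorConstLp 2 (measurableSet_closedBall (x := z) (ε := r))
    measure_closedBall_lt_top.ne ((volume.real (Metric.closedBall z r) : ℂ)⁻¹)

lemma inner_normalizedDisc (z : ℂ) (r : ℝ) (g : Lp ℂ 2 (volume : Measure ℂ)) :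
    inner ℂ (normalizedDisc z r) g = ⨍ x in Metric.closedBall z r, g x := by
  rw [normalizedDisc, L2.inner_indicatorConstLp_eq_inner_setIntegral, setAverage_eq]
  simp [mul_comm]

lemma integral_mul_normalizedDisc (z : ℂ) (r : ℝ) (k : ℂ → ℂ) :
    ∫ w, k w * normalizedDisc z r w = ⨍ w in Metric.closedBall z r, k w := by
  rw [setAverage_eq, ← integral_smul, ← integral_indicator measurableSet_closedBall]
  refine integral_congr_ae ?_
  filter_upwards [indicatorConstLp_coeFn (p := 2)
    (hs := measurableSet_closedBall (x := z) (ε := r)) (hμs := measure_closedBall_lt_top.ne)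
    (c := ((volume.real (Metric.closedBall z r) : ℂ)⁻¹)) (μ := volume)] with w hw
  rw [normalizedDisc, hw]
  by_cases h : w ∈ Metric.closedBall z r <;> simp [h, mul_comm]

section Kernel

variable {K : ℂ → ℂ → ℂ} {T : Lp ℂ 2 (volume : Measure ℂ) →L[ℂ] Lp ℂ 2 (volume : Measure ℂ)}

lemma apply_normalizedDisc_ae
    (hT : ∀ g : Lp ℂ 2 (volume : Measure ℂ), ∀ᵐ z : ℂ, (T g : ℂ → ℂ) z = ∫ w, K z w * g w)
    (z : ℂ) (r : ℝ) :
    (T (normalizedDisc z r) : ℂ → ℂ) =ᵐ[volume] fun u => ⨍ w in Metric.closedBall z r, K u w := by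
  filter_upwards [hT (normalizedDisc z r)] with u hu
  rw [hu, integral_mul_normalizedDisc]

/-- Testing an integral operator with continuous kernel against shrinking discs recovers the
diagonal values of the kernel. -/
lemma tendsto_inner_normalizedDisc (hK : Continuous fun p : ℂ × ℂ => K p.1 p.2)
    (hT : ∀ g : Lp ℂ 2 (volume : Measure ℂ), ∀ᵐ z : ℂ, (T g : ℂ → ℂ) z = ∫ w, K z w * g w)
    (z : ℂ) :
    Tendsto (fun r => inner ℂ (normalizedDisc z r) (T (normalizedDisc z r))) (𝓝[>] 0)
      (𝓝 (K z z)) := by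
  rw [Metric.tendsto_nhds]
  intro η hη
  obtain ⟨d, hd, h⟩ := Metric.continuous_iff.1 hK (z, z) (η / 2) (half_pos hη)
  filter_upwards [Ioo_mem_nhdsGT hd] with r hr
  have hpos : volume (Metric.closedBall z r) ≠ 0 := (Metric.measure_closedBall_pos _ _ hr.1).ne'
  rw [inner_normalizedDisc]
  refine (dist_setAverage_le hpos measure_closedBall_lt_top.ne ?_ ?_).trans_lt (half_lt_self hη)
  · filter_upwards [ae_restrict_of_ae (apply_normalizedDisc_ae hT z r),
      ae_restrict_mem measurableSet_closedBall] with u hu hmem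
    rw [hu]
    refine dist_setAverage_le hpos measure_closedBall_lt_top.ne ?_ ?_
    · filter_upwards [ae_restrict_mem measurableSet_closedBall] with w hw
      refine (h (u, w) ?_).le
      rw [Prod.dist_eq]
      exact (max_le hmem hw).trans_lt hr.2
    · exact (hK.comp (Continuous.prodMk_right u)).continuousOn.integrableOn_compact
        (isCompact_closedBall z r)
  · exact integrableOn_Lp_of_measure_ne_top _ one_le_two measure_closedBall_lt_top.ne

/-- Pointwise convergence of the averages of the kernel over shrinking discs. -/
lemma tendsto_average_kernel (hK : Continuous fun p : ℂ × ℂ => K p.1 p.2) (u z : ℂ) :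
    Tendsto (fun r => ⨍ w in Metric.closedBall z r, K u w) (𝓝[>] 0) (𝓝 (K u z)) := by
  have hc : Continuous (K u) := hK.comp (Continuous.prodMk_right u)
  rw [Metric.tendsto_nhds]
  intro η hη
  obtain ⟨d, hd, h⟩ := Metric.continuous_iff.1 hc z (η / 2) (half_pos hη)
  filter_upwards [Ioo_mem_nhdsGT hd] with r hr
  refine (dist_setAverage_le (Metric.measure_closedBall_pos _ _ hr.1).ne'
    measure_closedBall_lt_top.ne ?_ ?_).trans_lt (half_lt_self hη)
  · filter_upwards [ae_restrict_mem measurableSet_closedBall] with w hw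
    exact (h w (lt_of_le_of_lt hw hr.2)).le
  · exact hc.continuousOn.integrableOn_compact (isCompact_closedBall z r)

lemma lintegral_kernel_le_liminf (hK : Continuous fun p : ℂ × ℂ => K p.1 p.2)
    (hT : ∀ g : Lp ℂ 2 (volume : Measure ℂ), ∀ᵐ z : ℂ, (T g : ℂ → ℂ) z = ∫ w, K z w * g w)
    (z : ℂ) :
    ∫⁻ u, ‖K u z‖ₑ ^ 2 ≤ liminf (fun r => ‖T (normalizedDisc z r)‖ₑ ^ 2) (𝓝[>] 0) := by
  have h1 : ∀ r, ‖T (normalizedDisc z r)‖ₑ ^ 2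
      = ∫⁻ u, ‖⨍ w in Metric.closedBall z r, K u w‖ₑ ^ 2 := fun r => by
    rw [enorm_Lp_two_sq]
    refine lintegral_congr_ae ?_
    filter_upwards [apply_normalizedDisc_ae hT z r] with u hu
    rw [hu]
  simp_rw [h1]
  refine le_trans (lintegral_mono fun u => ?_) (lintegral_liminf_le' fun r => ?_)
  · exact (ENNReal.Tendsto.pow ((continuous_enorm.tendsto _).comp
      (tendsto_average_kernel hK u z))).liminf_eq.ge
  · exact (((Lp.aestronglyMeasurable _).congr
      (apply_normalizedDisc_ae hT z r)).enorm).pow_const 2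

/-- If the diagonal of `K` does not exceed the diagonal of the kernel of `T²`, then `T` is a
projection. -/
lemma eq_comp_self_of_diag_le (hK : Continuous fun p : ℂ × ℂ => K p.1 p.2)
    (hT : ∀ g : Lp ℂ 2 (volume : Measure ℂ), ∀ᵐ z : ℂ, (T g : ℂ → ℂ) z = ∫ w, K z w * g w)
    (hTpos : T.IsPositive) (hspec : spectrum ℂ T ⊆ Set.Icc (0 : ℂ) 1)
    (hint : ∀ z, Integrable fun u => ‖K u z‖ ^ 2)
    (hdiag : ∀ z, (K z z).re ≤ ∫ u, ‖K u z‖ ^ 2) : T = T ∘L T := by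
  obtain ⟨S, hSinner⟩ := exists_inner_eq_of_nonneg (nonneg_sub_comp_self hTpos hspec)
  have hSsq : ∀ x, ‖S x‖ ^ 2 = (inner ℂ x (T x)).re - ‖T x‖ ^ 2 := fun x => by
    have h1 : inner ℂ (T x) (T x) = inner ℂ x (T (T x)) := hTpos.isSymmetric x (T x)
    have h2 := hSinner x x
    rw [sub_apply, inner_sub_right, ContinuousLinearMap.comp_apply, ← h1,
      inner_self_eq_norm_sq_to_K, inner_self_eq_norm_sq_to_K] at h2
    have h3 := congrArg Complex.re h2
    simpa [← Complex.ofReal_pow] using h3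
  have hzero : ∀ z, Tendsto (fun r => S (normalizedDisc z r)) (𝓝[>] 0) (𝓝 0) := fun z => by
    rw [Metric.tendsto_nhds]
    intro η hη
    have hη2 : 0 < η ^ 2 / 2 := by positivity
    have ha := (Complex.continuous_re.tendsto _).comp (tendsto_inner_normalizedDisc hK hT z)
    have hb : ∀ᶠ r in 𝓝[>] (0 : ℝ),
        (∫ u, ‖K u z‖ ^ 2) - η ^ 2 / 2 < ‖T (normalizedDisc z r)‖ ^ 2 := by
      rcases lt_or_ge ((∫ u, ‖K u z‖ ^ 2) - η ^ 2 / 2) 0 with hneg | hnn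
      · exact Eventually.of_forall fun r => hneg.trans_le (sq_nonneg _)
      have hI : ENNReal.ofReal (∫ u, ‖K u z‖ ^ 2) = ∫⁻ u, ‖K u z‖ₑ ^ 2 := by
        rw [ofReal_integral_eq_lintegral_ofReal (hint z) (ae_of_all _ fun u => sq_nonneg _)]
        refine lintegral_congr fun u => ?_
        rw [ENNReal.ofReal_pow (norm_nonneg _), ofReal_norm]
      have hlt : ENNReal.ofReal ((∫ u, ‖K u z‖ ^ 2) - η ^ 2 / 2)
          < liminf (fun r => ‖T (normalizedDisc z r)‖ₑ ^ 2) (𝓝[>] 0) := by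
        refine lt_of_lt_of_le ?_ (lintegral_kernel_le_liminf hK hT z)
        rw [← hI, ENNReal.ofReal_lt_ofReal_iff (by linarith)]
        linarith
      filter_upwards [eventually_lt_of_lt_liminf hlt] with r hr
      rw [← ofReal_norm, ← ENNReal.ofReal_pow (norm_nonneg _)] at hr
      exact (ENNReal.ofReal_lt_ofReal_iff_of_nonneg hnn).1 hr
    filter_upwards [hb, ha.eventually_lt_const (lt_add_of_pos_right (K z z).re hη2)] with r h1 h2
    rw [dist_zero_right]
    refine lt_of_pow_lt_pow_left₀ 2 hη.le ?_
    rw [hSsq]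
    have := hdiag z
    simp only [Function.comp_apply] at h2
    linarith
  refine sub_eq_zero.1 (ContinuousLinearMap.ext fun g => ?_)
  rw [zero_apply, Lp.eq_zero_iff_ae_eq_zero]
  have hloc : LocallyIntegrable ((T - T ∘L T) g : ℂ → ℂ) volume :=
    (Lp.memLp _).locallyIntegrable (by norm_num)
  filter_upwards [IsUnifLocDoublingMeasure.ae_tendsto_average volume hloc 1] with z hz
  have h1 := hz (l := 𝓝[>] (0 : ℝ)) (fun _ => z) id tendsto_id (by
    filter_upwards [self_mem_nhdsWithin] with r hr
    simpa using le_of_lt hr)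
  have h2 : Tendsto (fun r => inner ℂ (S (normalizedDisc z r)) (S g)) (𝓝[>] 0)
      (𝓝 (inner ℂ 0 (S g))) := (hzero z).inner tendsto_const_nhds
  simp_rw [hSinner, inner_normalizedDisc, inner_zero_left] at h2
  exact tendsto_nhds_unique h1 h2

end Kernel

/-- Dilating a squared density by `√ρ` and scaling by `ρ²` multiplies its mass by `ρ`. -/
lemma integral_dilation_sq (φ : ℂ → ℝ) {ρ : ℝ} (hρ : 0 < ρ) :
    ∫ w, (ρ * φ ((Real.sqrt ρ : ℂ) * w)) ^ 2 = ρ * ∫ w, φ w ^ 2 := by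
  have h := Measure.integral_comp_smul (volume : Measure ℂ) (fun w => (ρ * φ w) ^ 2) (Real.sqrt ρ)
  simp only [Complex.real_smul, Complex.finrank_real_complex, Real.sq_sqrt hρ.le, smul_eq_mul,
    abs_of_pos (inv_pos.2 hρ), mul_pow, integral_const_mul] at h
  simp only [mul_pow, integral_const_mul, h]
  field_simp

lemma integrable_dilation_sq {φ : ℂ → ℝ} (hφ : Integrable fun z => φ z ^ 2) {ρ : ℝ} (hρ : 0 < ρ) :
    Integrable fun w => (ρ * φ ((Real.sqrt ρ : ℂ) * w)) ^ 2 := by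
  have h := (hφ.comp_smul (Real.sqrt_pos.2 hρ).ne').const_mul (ρ ^ 2)
  simpa only [mul_pow, Complex.real_smul] using h

/-- The smooth part of the variance is bounded by the `L²` norm of the linear statistic. -/
lemma integral_sq_sub_mul_le {f ψ : ℂ → ℝ} (hf : Continuous f) (hs : HasCompactSupport f)
    (hψc : Continuous ψ) (hψ0 : 0 ≤ ψ) (hψ : Integrable ψ) :
    ∫ z, ∫ w, (f z - f w) ^ 2 * ψ (z - w) ≤ 4 * (∫ z, f z ^ 2) * ∫ z, ψ z := by
  have hs2 : HasCompactSupport fun z => f z ^ 2 := hs.comp_left (g := fun x => x ^ 2) (by simp)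
  have hf2 : Integrable fun z => f z ^ 2 := (hf.pow 2).integrable_of_hasCompactSupport hs2
  set L := ContinuousLinearMap.mul ℝ ℝ
  have hconv := hf2.integrable_convolution L hψ
  have hconv_eq : ∫ z, ∫ w, f w ^ 2 * ψ (z - w) = (∫ z, f z ^ 2) * ∫ z, ψ z :=
    integral_convolution L hf2 hψ
  have hinner : ∀ z, ∫ w, (f z - f w) ^ 2 * ψ (z - w)
      ≤ 2 * (f z ^ 2 * ∫ w, ψ w) + 2 * ∫ w, f w ^ 2 * ψ (z - w) := fun z => by
    have h1 : Integrable fun w => 2 * (f z ^ 2 * ψ (z - w)) :=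
      ((hψ.comp_sub_left z).const_mul _).const_mul _
    have h2 : Integrable fun w => 2 * (f w ^ 2 * ψ (z - w)) :=
      (((hf.pow 2).mul (hψc.comp (continuous_const.sub continuous_id))).integrable_of_hasCompactSupport
        hs2.mul_right).const_mul _
    rw [← integral_sub_left_eq_self ψ volume z, ← integral_const_mul, ← integral_const_mul,
      ← integral_const_mul, ← integral_add h1 h2]
    refine integral_mono_of_nonneg (ae_of_all _ fun w => mul_nonneg (sq_nonneg _) (hψ0 _))
      (h1.add h2) (ae_of_all _ fun w => ?_)
    have := mul_le_mul_of_nonneg_right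
      (show (f z - f w) ^ 2 ≤ 2 * f z ^ 2 + 2 * f w ^ 2 by nlinarith [sq_nonneg (f z + f w)])
      (hψ0 (z - w))
    linarith
  have h1 : Integrable fun z => 2 * (f z ^ 2 * ∫ w, ψ w) := (hf2.mul_const _).const_mul _
  have h2 : Integrable fun z => 2 * ∫ w, f w ^ 2 * ψ (z - w) := hconv.const_mul 2
  refine (integral_mono_of_nonneg (ae_of_all _ fun z => integral_nonneg fun w =>
    mul_nonneg (sq_nonneg _) (hψ0 _)) (h1.add h2) (ae_of_all _ hinner)).trans_eq ?_
  rw [integral_add' h1 h2, integral_const_mul, integral_const_mul, integral_mul_const, hconv_eq]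
  ring

/-- let `X` be the DPP on `ℂ` with dilated kernel
`K_ρ(z,w) = ρ K(√ρ z, √ρ w)`, where `|K(z,w)| = φ(z−w)`, `φ` bounded continuous, the
integral operator `T_K` is bounded with spectrum in `[0,1]` but is not a projection.
Then for every non-zero compactly supported `C³` function `f`,
`liminf_{ρ→∞} ρ⁻¹ Var[Tr_ρ(f)] > 0`.  The variance is given by the general identity
`Var[Tr_ρ(f)] = ½∫∫ (f(z)−f(w))² |K_ρ(z,w)|² dA dA
  + ∫ f(z)² [K_ρ(z,z) − ∫ |K_ρ(z,w)|² dA(w)] dA(z)`, imposed as a hypothesis on `V`. -/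
theorem non_reproducing_variance_liminf_pos
    (K : ℂ → ℂ → ℂ) (φ : ℂ → ℝ) (f : ℂ → ℝ) (V : ℝ → ℝ)
    (hKcont : Continuous fun p : ℂ × ℂ => K p.1 p.2)
    (hherm : ∀ z w, K z w = starRingEnd ℂ (K w z))
    (habs : ∀ z w, ‖K z w‖ = φ (z - w))
    (hφc : Continuous φ) (hφ0 : ∀ z, 0 ≤ φ z) (hφb : ∃ M, ∀ z, φ z ≤ M)
    (hφ2 : Integrable fun z => φ z ^ 2)
    (T : Lp ℂ 2 (volume : Measure ℂ) →L[ℂ] Lp ℂ 2 (volume : Measure ℂ))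
    (hT : ∀ g : Lp ℂ 2 (volume : Measure ℂ),
      ∀ᵐ z : ℂ, (T g : ℂ → ℂ) z = ∫ w, K z w * g w)
    (hTpos : T.IsPositive)
    (hspec : spectrum ℂ T ⊆ Set.Icc (0 : ℂ) 1)
    (hne : T ≠ T ∘L T)
    (hf : ContDiff ℝ 3 f) (hsupp : HasCompactSupport f) (hfne : f ≠ 0)
    (hV : ∀ ρ : ℝ, 0 < ρ →
      V ρ = (1 / 2) * (∫ z, ∫ w,
          (f z - f w) ^ 2
            * ‖(ρ : ℂ) * K ((Real.sqrt ρ : ℂ) * z) ((Real.sqrt ρ : ℂ) * w)‖ ^ 2)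
        + ∫ z, f z ^ 2 *
            (((ρ : ℂ) * K ((Real.sqrt ρ : ℂ) * z) ((Real.sqrt ρ : ℂ) * z)).re
              - ∫ w, ‖(ρ : ℂ) * K ((Real.sqrt ρ : ℂ) * z) ((Real.sqrt ρ : ℂ) * w)‖ ^ 2)) :
    0 < Filter.liminf (fun ρ : ℝ => V ρ / ρ) Filter.atTop := by
  have hdiag_re : ∀ z, (K z z).re = φ 0 := fun z => by
    have hnn : 0 ≤ (K z z).re :=
      ge_of_tendsto' ((Complex.continuous_re.tendsto _).comp
        (tendsto_inner_normalizedDisc hKcont hT z)) fun r => hTpos.re_inner_nonneg_right _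
    have him : (K z z).im = 0 := Complex.conj_eq_iff_im.1 (hherm z z).symm
    have habs' := habs z z
    rwa [sub_self, ← Complex.abs_re_eq_norm.2 him, abs_of_nonneg hnn] at habs'
  set I := ∫ z, φ z ^ 2
  have hKsq : ∀ z, (fun u => ‖K u z‖ ^ 2) = fun u => φ (u - z) ^ 2 := fun z => by
    funext u; rw [habs]
  have hgap : I < φ 0 := by
    by_contra! hle
    refine hne (eq_comp_self_of_diag_le hKcont hT hTpos hspec (fun z => ?_) fun z => ?_)
    · rw [hKsq]
      exact hφ2.comp_sub_right z
    · rw [hKsq, hdiag_re, integral_sub_right_eq_self (fun u => φ u ^ 2)]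
      exact hle
  have hI0 : 0 ≤ I := integral_nonneg fun z => sq_nonneg _
  set A := ∫ z, f z ^ 2
  have hA0 : 0 < A := by
    obtain ⟨x, hx⟩ := Function.ne_iff.1 hfne
    exact Continuous.integral_pos_of_hasCompactSupport_nonneg_nonzero (x := x)
      (hf.continuous.pow 2) (hsupp.comp_left (g := fun x => x ^ 2) (by simp))
      (fun z => sq_nonneg _) (pow_ne_zero 2 hx)
  have hbounds : ∀ ρ : ℝ, 0 < ρ →
      (φ 0 - I) * A ≤ V ρ / ρ ∧ V ρ / ρ ≤ 2 * A * I + (φ 0 - I) * A := fun ρ hρ => by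
    have hnorm : ∀ z w, ‖(ρ : ℂ) * K ((Real.sqrt ρ : ℂ) * z) ((Real.sqrt ρ : ℂ) * w)‖ ^ 2
        = (ρ * φ ((Real.sqrt ρ : ℂ) * (z - w))) ^ 2 := fun z w => by
      rw [norm_mul, habs, Complex.norm_of_nonneg hρ.le, mul_sub]
    have hre : ∀ z, ((ρ : ℂ) * K ((Real.sqrt ρ : ℂ) * z) ((Real.sqrt ρ : ℂ) * z)).re
        = ρ * φ 0 := fun z => by
      rw [Complex.re_ofReal_mul, hdiag_re]
    have hmass : ∀ z, ∫ w, (ρ * φ ((Real.sqrt ρ : ℂ) * (z - w))) ^ 2 = ρ * I := fun z => by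
      rw [integral_sub_left_eq_self (fun w => (ρ * φ ((Real.sqrt ρ : ℂ) * w)) ^ 2),
        integral_dilation_sq φ hρ]
    have hVρ := hV ρ hρ
    simp_rw [hnorm, hre, hmass, integral_mul_const] at hVρ
    have hlow : 0 ≤ ∫ z, ∫ w, (f z - f w) ^ 2 * (ρ * φ ((Real.sqrt ρ : ℂ) * (z - w))) ^ 2 :=
      integral_nonneg fun z => integral_nonneg fun w => by positivity
    have hup := integral_sq_sub_mul_le (ψ := fun w => (ρ * φ ((Real.sqrt ρ : ℂ) * w)) ^ 2)
      hf.continuous hsupp (by fun_prop) (fun z => sq_nonneg _) (integrable_dilation_sq hφ2 hρ)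
    rw [integral_dilation_sq φ hρ] at hup
    rw [le_div_iff₀ hρ, div_le_iff₀ hρ, hVρ]
    constructor <;> linarith
  have hev : ∀ᶠ ρ : ℝ in atTop, (φ 0 - I) * A ≤ V ρ / ρ :=
    (eventually_gt_atTop 0).mono fun ρ hρ => (hbounds ρ hρ).1
  have hbdd : IsBoundedUnder (· ≤ ·) atTop fun ρ : ℝ => V ρ / ρ :=
    isBoundedUnder_of_eventually_le
      ((eventually_gt_atTop 0).mono fun ρ hρ => (hbounds ρ hρ).2)
  exact (mul_pos (sub_pos.2 hgap) hA0).trans_le (le_liminf_of_le hbdd.isCoboundedUnder_ge hev)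
end
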